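/- arXiv:1905.12361 — 2 statements merged into one kernel-verified Lean document; each statement's English description precedes it below -/
import Mathlib

section
/- Let D₁,…,D_m be a polyhedral tiling of ℝⁿ. Then there exists a constant γ > 0 such that whenever a closed Euclidean ball of radius γ has nonempty intersection with each of three (not necessarily distinct) regions D_i, D_j, D_k, the intersection D_i ∩ D_j ∩ D_k is nonempty. -/
open Set MeasureTheory
open scoped RealInnerProductSpace

noncomputable section

abbrev Euc (n : ℕ) := EuclideanSpace ℝ (Fin n)

/-- A trajectory of a set-valued dynamical system `F`: a function on `[0,∞)`
whose derivative exists and lies in `F (x t)` outside a measure-zero set of times. -/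
def IsTrajectory {n : ℕ} (F : Euc n → Set (Euc n)) (x : ℝ → Euc n) : Prop :=
  ∃ N : Set ℝ, volume N = 0 ∧
    ∀ t ∈ Set.Ici (0 : ℝ) \ N, ∃ v ∈ F (x t), HasDerivAt x v t

/-- Nonexpansiveness: the Euclidean distance between any two trajectories is
nonincreasing in time. -/
def Nonexpansive {n : ℕ} (F : Euc n → Set (Euc n)) : Prop :=
  ∀ x y : ℝ → Euc n, IsTrajectory F x → IsTrajectory F y →
    ∀ t₁ t₂ : ℝ, 0 ≤ t₁ → t₁ ≤ t₂ → ‖x t₂ - y t₂‖ ≤ ‖x t₁ - y t₁‖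

/-- A polyhedron: a set defined by finitely many linear inequalities. -/
def IsPolyhedron {n : ℕ} (D : Set (Euc n)) : Prop :=
  ∃ (k : ℕ) (a : Fin k → Euc n) (c : Fin k → ℝ),
    D = {x | ∀ i, ⟪a i, x⟫ ≤ c i}

/-- A polyhedral tiling of ℝⁿ: finitely many polyhedra with nonempty interiors,
covering ℝⁿ, with pairwise disjoint interiors. -/
def IsPolyhedralTiling {n m : ℕ} (D : Fin m → Set (Euc n)) : Prop :=
  (∀ i, IsPolyhedron (D i)) ∧
  (∀ i, (interior (D i)).Nonempty) ∧
  (⋃ i, D i) = Set.univ ∧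
  (∀ i j, i ≠ j → interior (D i) ∩ interior (D j) = ∅)

/-- The polyhedral hybrid system associated with regions `D` and drifts `μ`:
`F x = conv {μ i : x ∈ D i}`. -/
def hybridSystem {n m : ℕ} (D : Fin m → Set (Euc n)) (μ : Fin m → Euc n) :
    Euc n → Set (Euc n) :=
  fun x => convexHull ℝ (μ '' {i | x ∈ D i})

/-- The subdifferential of `Φ` at `x`. -/
def subdiff {n : ℕ} (Φ : Euc n → ℝ) (x : Euc n) : Set (Euc n) :=
  {g | ∀ y, Φ x + ⟪g, y - x⟫ ≤ Φ y}

/-- Upper semicontinuity for set-valued maps. -/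
def USCSetMap {n : ℕ} (F : Euc n → Set (Euc n)) : Prop :=
  ∀ x, ∀ V : Set (Euc n), IsOpen V → F x ⊆ V →
    ∃ U : Set (Euc n), IsOpen U ∧ x ∈ U ∧ ∀ y ∈ U, F y ⊆ V

/-- A well-formed dynamical system. -/
def WellFormed {n : ℕ} (F : Euc n → Set (Euc n)) : Prop :=
  USCSetMap F ∧
  (∃ α : ℝ, ∀ x, ∀ v ∈ F x, ‖v‖ ≤ α * (1 + ‖x‖)) ∧
  (∀ x, IsClosed (F x) ∧ Convex ℝ (F x))

open Filter Topology in
lemma approx_feasible {V : Type*} [AddCommGroup V] [Module ℝ V] :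
    ∀ (N : ℕ) (ι : Type) [Fintype ι], Fintype.card ι = N → ∀ (f : ι → V →ₗ[ℝ] ℝ) (b : ι → ℝ),
      (∀ ε : ℝ, 0 < ε → ∃ x, ∀ i, f i x ≤ b i + ε) → ∃ x, ∀ i, f i x ≤ b i := by
  intro N
  induction N using Nat.strong_induction_on with
  | _ N ih =>
  intro ι _ hN f b h
  let F : V →ₗ[ℝ] (ι → ℝ) := LinearMap.pi f
  have hcl : IsClosed (LinearMap.range F : Set (ι → ℝ)) :=
    Submodule.closed_of_finiteDimensional _
  have hx : ∀ n : ℕ, ∃ x, ∀ i, f i x ≤ b i + 1 / ((n : ℝ) + 1) := fun n => h _ (by positivity)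
  choose x hx using hx
  have hlim : Tendsto (fun n : ℕ => 1 / ((n : ℝ) + 1)) atTop (𝓝 0) :=
    tendsto_one_div_add_atTop_nhds_zero_nat
  by_cases hb : ∃ R : ℝ, ∃ᶠ n in atTop, F (x n) ∈ Metric.closedBall (0 : ι → ℝ) R
  · obtain ⟨R, hR⟩ := hb
    obtain ⟨y, -, φ, hφ, hy⟩ :=
      tendsto_subseq_of_frequently_bounded Metric.isBounded_closedBall hR
    have hm : y ∈ (LinearMap.range F : Set (ι → ℝ)) :=
      hcl.mem_of_tendsto hy (Eventually.of_forall fun n => ⟨x (φ n), rfl⟩)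
    obtain ⟨v, rfl⟩ := hm
    refine ⟨v, fun i => ?_⟩
    have h1 : Tendsto (fun n => F (x (φ n)) i) atTop (𝓝 (F v i)) := (tendsto_pi_nhds.1 hy) i
    have h2 : Tendsto (fun n => b i + 1 / (((φ n : ℕ) : ℝ) + 1)) atTop (𝓝 (b i + 0)) :=
      tendsto_const_nhds.add (hlim.comp hφ.tendsto_atTop)
    rw [add_zero] at h2
    exact le_of_tendsto_of_tendsto' h1 h2 fun n => hx (φ n) i
  · push Not at hb
    have hinf : Tendsto (fun n => ‖F (x n)‖) atTop atTop := by
      rw [tendsto_atTop]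
      intro R
      filter_upwards [hb R] with n hn
      have : ¬ (‖F (x n)‖ ≤ R) := by simpa using hn
      linarith
    have hbd : ∀ n, ‖F (x n)‖⁻¹ • F (x n) ∈ Metric.closedBall (0 : ι → ℝ) 1 := by
      intro n
      rw [mem_closedBall_zero_iff, norm_smul, norm_inv, norm_norm]
      exact inv_mul_le_one
    obtain ⟨w, -, φ, hφ, hw⟩ :=
      tendsto_subseq_of_bounded Metric.isBounded_closedBall hbd
    have hm : w ∈ (LinearMap.range F : Set (ι → ℝ)) :=
      hcl.mem_of_tendsto hw (Eventually.of_forall fun n =>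
        ⟨‖F (x (φ n))‖⁻¹ • x (φ n), by simp⟩)
    obtain ⟨v, rfl⟩ := hm
    have hinf' := hinf.comp hφ.tendsto_atTop
    have hnorm : ‖F v‖ = 1 := by
      refine tendsto_nhds_unique hw.norm (tendsto_const_nhds.congr' ?_)
      filter_upwards [hinf'.eventually_gt_atTop 0] with n hn
      simp only [Function.comp] at hn ⊢
      rw [norm_smul, norm_inv, norm_norm, inv_mul_cancel₀ hn.ne']
    have hneg : ∀ i, f i v ≤ 0 := by
      intro i
      have h1 : Tendsto (fun n => ‖F (x (φ n))‖⁻¹ * F (x (φ n)) i) atTop (𝓝 (F v i)) :=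
        (tendsto_pi_nhds.1 hw) i
      have h2 : Tendsto (fun n => ‖F (x (φ n))‖⁻¹ * (b i + 1)) atTop (𝓝 (0 * (b i + 1))) :=
        (tendsto_inv_atTop_zero.comp hinf').mul_const _
      rw [zero_mul] at h2
      refine le_of_tendsto_of_tendsto' h1 h2 fun n => ?_
      refine mul_le_mul_of_nonneg_left ?_ (by positivity)
      refine (hx (φ n) i).trans ?_
      have : 1 / (((φ n : ℕ) : ℝ) + 1) ≤ 1 := by
        rw [div_le_one (by positivity)]
        have : (0 : ℝ) ≤ (φ n : ℕ) := Nat.cast_nonneg _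
        linarith
      linarith
    have hne : ∃ i, f i v ≠ 0 := by
      by_contra hc
      push Not at hc
      have : F v = 0 := funext hc
      rw [this] at hnorm
      simp at hnorm
    obtain ⟨i₀, hi₀⟩ := hne
    classical
    obtain ⟨u, hu⟩ := ih (Fintype.card {i // f i v = 0})
      (hN ▸ Fintype.card_subtype_lt hi₀) {i // f i v = 0} rfl (fun i => f i) (fun i => b i)
      (fun ε hε => (h ε hε).imp fun x hx i => hx i)
    have hev : ∀ᶠ t : ℝ in atTop, ∀ i, f i (u + t • v) ≤ b i := by
      rw [eventually_all]
      intro i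
      by_cases hi : f i v = 0
      · refine Eventually.of_forall fun t => ?_
        simpa [hi] using hu ⟨i, hi⟩
      · have hlt : f i v < 0 := lt_of_le_of_ne (hneg i) hi
        filter_upwards [eventually_ge_atTop ((b i - f i u) / f i v)] with t ht
        rw [div_le_iff_of_neg hlt] at ht
        simp only [map_add, map_smul, smul_eq_mul]
        linarith
    obtain ⟨t, ht⟩ := hev.exists
    exact ⟨_, ht⟩

open Filter Topology in
lemma near_polyhedron {n k : ℕ} (a : Fin k → Euc n) (b : Fin k → ℝ) (ε : ℝ) (hε : 0 < ε) :
    ∀ᶠ γ : ℝ in 𝓝[>] 0, ∀ c : Euc n,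
      (Metric.closedBall c γ ∩ {x | ∀ i, ⟪a i, x⟫ ≤ b i}).Nonempty →
        ∀ i, ⟪a i, c⟫ ≤ b i + ε := by
  have h : ∀ᶠ γ : ℝ in 𝓝[>] 0, ∀ i, ‖a i‖ * γ < ε := by
    rw [eventually_all]
    intro i
    have : Tendsto (fun γ : ℝ => ‖a i‖ * γ) (𝓝 0) (𝓝 (‖a i‖ * 0)) :=
      tendsto_id.const_mul _
    rw [mul_zero] at this
    exact (this.mono_left nhdsWithin_le_nhds).eventually_lt_const hε
  filter_upwards [h] with γ hγ c ⟨x, hx, hxD⟩ i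
  have h1 : ⟪a i, c⟫ = ⟪a i, x⟫ + ⟪a i, c - x⟫ := by rw [inner_sub_right]; ring
  have h2 : ⟪a i, c - x⟫ ≤ ‖a i‖ * ‖c - x‖ := real_inner_le_norm _ _
  have h3 : ‖c - x‖ ≤ γ := by
    rw [← dist_eq_norm, dist_comm]; exact hx
  have h4 := mul_le_mul_of_nonneg_left h3 (norm_nonneg (a i))
  have h5 := hxD i
  have h6 := hγ i
  linarith

/-- for a polyhedral tiling there is `γ > 0` such that whenever a
closed ball of radius `γ` meets each of three regions, the regions have a common point. -/
theorem stmt_7 {n m : ℕ} (D : Fin m → Set (Euc n)) (htiling : IsPolyhedralTiling D) :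
    ∃ γ : ℝ, 0 < γ ∧ ∀ (c : Euc n) (i j k : Fin m),
      (Metric.closedBall c γ ∩ D i).Nonempty →
      (Metric.closedBall c γ ∩ D j).Nonempty →
      (Metric.closedBall c γ ∩ D k).Nonempty →
      (D i ∩ D j ∩ D k).Nonempty := by

  classical
  obtain ⟨hpoly, -, -, -⟩ := htiling
  choose K a b hD using hpoly
  have key : ∀ᶠ γ : ℝ in nhdsWithin 0 (Set.Ioi 0), ∀ i j k : Fin m, ∀ c : Euc n,
      (Metric.closedBall c γ ∩ D i).Nonempty →
      (Metric.closedBall c γ ∩ D j).Nonempty →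
      (Metric.closedBall c γ ∩ D k).Nonempty →
      (D i ∩ D j ∩ D k).Nonempty := by
    simp only [Filter.eventually_all]
    intro i j k
    by_cases hne : (D i ∩ D j ∩ D k).Nonempty
    · exact Filter.Eventually.of_forall fun _ _ _ _ _ => hne
    · let A : Fin (K i) ⊕ Fin (K j) ⊕ Fin (K k) → Euc n :=
        Sum.elim (a i) (Sum.elim (a j) (a k))
      let B : Fin (K i) ⊕ Fin (K j) ⊕ Fin (K k) → ℝ :=
        Sum.elim (b i) (Sum.elim (b j) (b k))
      have hε : ∃ ε : ℝ, 0 < ε ∧ ∀ x, ∃ l, B l + ε < ⟪A l, x⟫ := by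
        by_contra hc
        push Not at hc
        obtain ⟨x, hx⟩ := approx_feasible _ _ rfl (fun l => (innerₛₗ ℝ (A l))) B
          (fun ε hε => (hc ε hε).imp fun x hx l => hx l)
        apply hne
        refine ⟨x, ⟨?_, ?_⟩, ?_⟩
        · rw [hD i]; exact fun l => hx (Sum.inl l)
        · rw [hD j]; exact fun l => hx (Sum.inr (Sum.inl l))
        · rw [hD k]; exact fun l => hx (Sum.inr (Sum.inr l))
      obtain ⟨ε, hε, hx⟩ := hε
      filter_upwards [near_polyhedron (a i) (b i) ε hε, near_polyhedron (a j) (b j) ε hε,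
        near_polyhedron (a k) (b k) ε hε] with γ h1 h2 h3 c hi hj hk
      rw [hD i] at hi
      rw [hD j] at hj
      rw [hD k] at hk
      exfalso
      obtain ⟨l, hl⟩ := hx c
      rcases l with l | l | l
      · exact absurd (h1 c hi l) (not_le.2 hl)
      · exact absurd (h2 c hj l) (not_le.2 hl)
      · exact absurd (h3 c hk l) (not_le.2 hl)
  obtain ⟨γ, hγ, hpos⟩ := (key.and self_mem_nhdsWithin).exists
  exact ⟨γ, hpos, fun c i j k => hγ i j k c⟩
end
end

section
/- Let Φ : ℝⁿ → ℝ be convex and differentiable, and let x(·), y(·) : [0,∞) → ℝⁿ be differentiable functions satisfying ẋ(t) = −∇Φ(x(t)) and ẏ(t) = −∇Φ(y(t)) for all t ≥ 0. Then the function t ↦ ‖x(t) − y(t)‖ is nonincreasing on [0,∞); in particular ‖x(t₂) − y(t₂)‖ ≤ ‖x(t₁) − y(t₁)‖ whenever 0 ≤ t₁ ≤ t₂. -/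
open Set MeasureTheory
open scoped RealInnerProductSpace

noncomputable section

/-- First-order condition for convexity. -/
lemma gradient_ineq {n : ℕ} {Φ : Euc n → ℝ}
    (hconv : ConvexOn ℝ Set.univ Φ) (hdiff : Differentiable ℝ Φ) (a b : Euc n) :
    ⟪gradient Φ a, b - a⟫ ≤ Φ b - Φ a := by
  have hc : ConvexOn ℝ Set.univ (Φ ∘ AffineMap.lineMap (k := ℝ) a b) := by
    simpa using hconv.comp_affineMap (AffineMap.lineMap (k := ℝ) a b)
  have hd : HasDerivAt (Φ ∘ AffineMap.lineMap (k := ℝ) a b) ⟪gradient Φ a, b - a⟫ 0 := by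
    have h1 : HasDerivAt (AffineMap.lineMap (k := ℝ) a b) (b - a) (0 : ℝ) :=
      AffineMap.hasDerivAt_lineMap
    have h2 := (hdiff (AffineMap.lineMap (k := ℝ) a b (0 : ℝ))).hasGradientAt.hasFDerivAt
    have h3 := h2.comp_hasDerivAt (0 : ℝ) h1
    simpa using h3
  have := hc.le_slope_of_hasDerivAt (Set.mem_univ 0) (Set.mem_univ 1) one_pos hd
  simpa [slope] using this

/-- the gradient flow of a convex differentiable potential is nonexpansive. -/
theorem stmt_15 {n : ℕ} (Φ : Euc n → ℝ)
    (hconv : ConvexOn ℝ Set.univ Φ) (hdiff : Differentiable ℝ Φ)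
    (x y : ℝ → Euc n)
    (hx : ∀ t : ℝ, 0 ≤ t → HasDerivAt x (-(gradient Φ (x t))) t)
    (hy : ∀ t : ℝ, 0 ≤ t → HasDerivAt y (-(gradient Φ (y t))) t) :
    AntitoneOn (fun t => ‖x t - y t‖) (Set.Ici 0) ∧
    ∀ t₁ t₂ : ℝ, 0 ≤ t₁ → t₁ ≤ t₂ → ‖x t₂ - y t₂‖ ≤ ‖x t₁ - y t₁‖ := by
  have key : AntitoneOn (fun t => ‖x t - y t‖ ^ 2) (Set.Ici 0) := by
    have hd : ∀ t : ℝ, 0 ≤ t → HasDerivAt (fun t => ‖x t - y t‖ ^ 2)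
        (2 * ⟪x t - y t, -(gradient Φ (x t)) - -(gradient Φ (y t))⟫) t :=
      fun t ht => ((hx t ht).sub (hy t ht)).norm_sq
    refine antitoneOn_of_deriv_nonpos (convex_Ici 0)
      (fun t ht => (hd t ht).continuousAt.continuousWithinAt) ?_ ?_
    · intro t ht
      exact (hd t (interior_subset ht)).differentiableAt.differentiableWithinAt
    · intro t ht
      rw [(hd t (interior_subset ht)).deriv]
      have h1 := gradient_ineq hconv hdiff (x t) (y t)
      have h2 := gradient_ineq hconv hdiff (y t) (x t)
      rw [real_inner_comm]
      simp only [inner_sub_left, inner_sub_right, inner_neg_left] at *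
      linarith
  have main : AntitoneOn (fun t => ‖x t - y t‖) (Set.Ici 0) := fun s hs t ht hst =>
    (sq_le_sq₀ (norm_nonneg _) (norm_nonneg _)).1 (key hs ht hst)
  exact ⟨main, fun s t hs hst => main hs (hs.trans hst) hst⟩
end
end
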